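/- Let a, b > 0 satisfy the nine inequalities 2a + b ≥ 1, 3a + 4b ≥ 2, 9a + 11b ≥ 6, a + 5b ≥ 1, 4a + 9b ≥ 3, 10a + 16b ≥ 7, 13a + 20b ≥ 8, 5a + 14b ≥ 4, a + (3/2)b ≥ 2/3. Let G be a graph with no triangle adjacent to a 4-cycle such that α(G) < |V(G)| − (a|V(G)| + b|E(G)| + bλ(G)), and suppose every graph G' with fewer vertices than G and no triangle adjacent to a 4-cycle satisfies α(G') ≥ |V(G')| − (a|V(G')| + b|E(G')| + bλ(G')). Then the minimum degree of G is at least two. -/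

import Mathlib

namespace Paper

/-- `s` is an independent set in the simple graph `G`. -/
def IsIndepSet {V : Type} (G : SimpleGraph V) (s : Finset V) : Prop :=
  ∀ v ∈ s, ∀ w ∈ s, ¬ G.Adj v w

/-- The independence number `α(G)`: the size of a largest independent set. -/
noncomputable def indepNum {V : Type} (G : SimpleGraph V) : ℕ :=
  sSup {n | ∃ s : Finset V, IsIndepSet G s ∧ s.card = n}

/-- The number of edges `|E(G)|`. -/
noncomputable def numEdges {V : Type} (G : SimpleGraph V) : ℕ :=
  Nat.card G.edgeSet

/-- The degree of a vertex. -/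
noncomputable def deg {V : Type} (G : SimpleGraph V) (v : V) : ℕ :=
  Nat.card (G.neighborSet v)

/-- `G` contains a triangle sharing a common edge with a 4-cycle:
the triangle `u v w` and the 4-cycle `u v x y` share the edge `u v`. -/
def HasTriangleAdjC4 {V : Type} (G : SimpleGraph V) : Prop :=
  ∃ u v w x y : V, G.Adj u v ∧ G.Adj v w ∧ G.Adj w u ∧
    G.Adj v x ∧ G.Adj x y ∧ G.Adj y u ∧ u ≠ x ∧ v ≠ y

/-- `G` contains two triangles sharing a common edge:
the triangles `u v w` and `u v x` share the edge `u v`. -/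
def HasAdjTriangles {V : Type} (G : SimpleGraph V) : Prop :=
  ∃ u v w x : V, G.Adj u v ∧ G.Adj v w ∧ G.Adj w u ∧
    G.Adj v x ∧ G.Adj x u ∧ w ≠ x

/-- `G` contains a triangle sharing a common edge with a 5-cycle:
the triangle `u v w` and the 5-cycle `u v x y z` share the edge `u v`. -/
def HasTriangleAdjC5 {V : Type} (G : SimpleGraph V) : Prop :=
  ∃ u v w x y z : V, G.Adj u v ∧ G.Adj v w ∧ G.Adj w u ∧
    G.Adj v x ∧ G.Adj x y ∧ G.Adj y z ∧ G.Adj z u ∧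
    u ≠ x ∧ u ≠ y ∧ v ≠ y ∧ v ≠ z ∧ x ≠ z

/-- The 2-chain of triangles: two disjoint triangles `{0,1,2}` and `{3,4,5}`
joined by the single edge `{2,3}` (6 vertices, 7 edges). -/
def chainGraph : SimpleGraph (Fin 6) :=
  SimpleGraph.fromRel (fun i j =>
    (i.val, j.val) ∈ [(0,1), (0,2), (1,2), (3,4), (3,5), (4,5), (2,3)])

/-- A connected component is difficult if it is a triangle or a 2-chain of triangles. -/
def IsDifficult {V : Type} (G : SimpleGraph V) (c : G.ConnectedComponent) : Prop :=
  Nonempty (SimpleGraph.induce c.supp G ≃g (⊤ : SimpleGraph (Fin 3))) ∨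
  Nonempty (SimpleGraph.induce c.supp G ≃g chainGraph)

/-- `λ(G)`: the number of difficult components of `G`. -/
noncomputable def lambda {V : Type} (G : SimpleGraph V) : ℕ :=
  Nat.card {c : G.ConnectedComponent // IsDifficult G c}

/-- `Φ(S)`: the number of edges of `G` with exactly one endpoint in `S`. -/
noncomputable def phi {V : Type} (G : SimpleGraph V) (S : Set V) : ℕ :=
  Nat.card {e : Sym2 V | e ∈ G.edgeSet ∧ ∃ x ∈ S, ∃ y, y ∉ S ∧ e = s(x, y)}

theorem IsIndepSet.card_le_indepNum {V : Type} [Fintype V] {G : SimpleGraph V} {s : Finset V}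
    (hs : IsIndepSet G s) : s.card ≤ indepNum G :=
  le_csSup ⟨Fintype.card V, by rintro n ⟨t, -, rfl⟩; exact t.card_le_univ⟩ ⟨s, hs, rfl⟩

theorem exists_isIndepSet_card_eq_indepNum {V : Type} [Fintype V] (G : SimpleGraph V) :
    ∃ s : Finset V, IsIndepSet G s ∧ s.card = indepNum G :=
  Nat.sSup_mem (s := {n | ∃ s : Finset V, IsIndepSet G s ∧ s.card = n})
    ⟨0, ∅, by simp [IsIndepSet], rfl⟩
    ⟨Fintype.card V, by rintro n ⟨t, -, rfl⟩; exact t.card_le_univ⟩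

/-- Deleting a set that contains a vertex together with all its neighbours decreases the
independence number. -/
theorem indepNum_induce_compl_add_one_le {V : Type} [Fintype V] (G : SimpleGraph V) {S : Set V}
    [Fintype ↥Sᶜ] {v : V} (hv : v ∈ S) (hN : ∀ w, G.Adj v w → w ∈ S) :
    indepNum (G.induce Sᶜ) + 1 ≤ indepNum G := by
  classical
  obtain ⟨s, hs, hcard⟩ := exists_isIndepSet_card_eq_indepNum (G.induce Sᶜ)
  have hmem : ∀ x ∈ s.map (Function.Embedding.subtype _), x ∉ S := by
    intro x hx
    obtain ⟨y, -, rfl⟩ := Finset.mem_map.1 hx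
    exact y.2
  have hvs : v ∉ s.map (Function.Embedding.subtype _) := fun h => hmem v h hv
  have hind : IsIndepSet G (insert v (s.map (Function.Embedding.subtype _))) := by
    intro x hx y hy hxy
    rcases Finset.mem_insert.1 hx with rfl | hx' <;> rcases Finset.mem_insert.1 hy with rfl | hy'
    · exact G.loopless.irrefl _ hxy
    · exact hmem _ hy' (hN _ hxy)
    · exact hmem _ hx' (hN _ hxy.symm)
    · obtain ⟨p, hp, rfl⟩ := Finset.mem_map.1 hx'
      obtain ⟨q, hq, rfl⟩ := Finset.mem_map.1 hy'
      exact hs p hp q hq hxy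
  have := hind.card_le_indepNum
  rwa [Finset.card_insert_of_notMem hvs, Finset.card_map, hcard] at this

theorem HasTriangleAdjC4.of_induce {V : Type} {G : SimpleGraph V} {S : Set V}
    (h : HasTriangleAdjC4 (G.induce S)) : HasTriangleAdjC4 G := by
  obtain ⟨u, v, w, x, y, h₁, h₂, h₃, h₄, h₅, h₆, h₇, h₈⟩ := h
  exact ⟨u, v, w, x, y, h₁, h₂, h₃, h₄, h₅, h₆, fun h => h₇ (Subtype.ext h),
    fun h => h₈ (Subtype.ext h)⟩

theorem numEdges_induce {V : Type} (G : SimpleGraph V) (S : Set V) :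
    numEdges (G.induce S) = {e | e ∈ G.edgeSet ∧ ∀ x ∈ e, x ∈ S}.ncard := by
  have himage : Sym2.map Subtype.val '' (G.induce S).edgeSet =
      {e | e ∈ G.edgeSet ∧ ∀ x ∈ e, x ∈ S} := by
    ext e
    constructor
    · rintro ⟨e, he, rfl⟩
      induction e with | _ x y
      exact ⟨he, by simp⟩
    · rintro ⟨he, hS⟩
      induction e with | _ x y
      exact ⟨s(⟨x, hS x (by simp)⟩, ⟨y, hS y (by simp)⟩), he, rfl⟩
  rw [← himage, Set.ncard_image_of_injective _ (Sym2.map.injective Subtype.val_injective)]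
  rfl

/-- Every edge lies inside `S`, outside `S`, or on the boundary of `S`. -/
theorem numEdges_induce_add_phi_add_le {V : Type} [Finite V] (G : SimpleGraph V) (S : Set V) :
    numEdges (G.induce Sᶜ) + phi G S + numEdges (G.induce S) ≤ numEdges G := by
  rw [numEdges_induce, numEdges_induce]
  change _ + Set.ncard {e : Sym2 V | e ∈ G.edgeSet ∧ ∃ x ∈ S, ∃ y, y ∉ S ∧ e = s(x, y)} + _ ≤
    Set.ncard G.edgeSet
  rw [← Set.ncard_union_eq, ← Set.ncard_union_eq]
  · refine Set.ncard_le_ncard ?_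
    rintro e ((he | he) | he) <;> exact he.1
  · refine Set.disjoint_left.2 ?_
    rintro e (⟨-, he⟩ | ⟨-, x, hx, y, hy, rfl⟩) ⟨-, he'⟩
    · induction e with | _ x y
      exact he x (by simp) (he' x (by simp))
    · exact hy (he' y (by simp))
  · refine Set.disjoint_left.2 ?_
    rintro e ⟨-, he⟩ ⟨-, x, hx, y, hy, rfl⟩
    exact he x (by simp) hx

/-- The component of `G` containing a given component of an induced subgraph. -/
noncomputable def extendComponent {V : Type} {G : SimpleGraph V} {T : Set V}
    (c : (G.induce T).ConnectedComponent) : G.ConnectedComponent :=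
  c.map (SimpleGraph.Embedding.induce T).toHom

theorem supp_extendComponent {V : Type} {G : SimpleGraph V} {T : Set V}
    (c : (G.induce T).ConnectedComponent)
    (hc : ∀ x ∈ c.supp, ∀ y, G.Adj x y → y ∈ T) :
    (extendComponent c).supp = Subtype.val '' c.supp := by
  ext y
  constructor
  · intro hy
    obtain ⟨x, rfl⟩ := c.exists_rep
    have hreach : G.Reachable x.1 y := (SimpleGraph.ConnectedComponent.exact hy).symm
    rw [SimpleGraph.reachable_iff_reflTransGen] at hreach
    induction hreach with
    | refl => exact ⟨x, rfl, rfl⟩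
    | @tail y z hxy hyz ih =>
      obtain ⟨w, hw, rfl⟩ := ih
        (SimpleGraph.ConnectedComponent.sound
          ((SimpleGraph.reachable_iff_reflTransGen _ _).2 hxy).symm)
      refine ⟨⟨z, hc w hw z hyz⟩, ?_, rfl⟩
      have hadj : (G.induce T).Adj ⟨z, hc w hw z hyz⟩ w := hyz.symm
      exact (SimpleGraph.ConnectedComponent.sound hadj.reachable).trans hw
  · rintro ⟨x, hx, rfl⟩
    obtain rfl : (G.induce T).connectedComponentMk x = c := hx
    rfl

theorem IsDifficult.extendComponent {V : Type} {G : SimpleGraph V} {T : Set V}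
    {c : (G.induce T).ConnectedComponent} (h : IsDifficult (G.induce T) c)
    (hc : ∀ x ∈ c.supp, ∀ y, G.Adj x y → y ∈ T) :
    IsDifficult G (extendComponent c) := by
  let image := Equiv.Set.image Subtype.val c.supp Subtype.val_injective
  have himage (z) : ((image.symm z).1 : V) = z := congrArg Subtype.val (image.apply_symm_apply z)
  have e : G.induce (Paper.extendComponent c).supp ≃g (G.induce T).induce c.supp :=
    { toEquiv := (Equiv.setCongr (supp_extendComponent c hc)).trans image.symm
      map_rel_iff' := by
        intro x y
        simp [himage] }
  exact h.imp (fun ⟨f⟩ => ⟨e.trans f⟩) (fun ⟨f⟩ => ⟨e.trans f⟩)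

/-- Each difficult component created by deleting `S` sends an edge to `S`. -/
theorem lambda_induce_compl_le {V : Type} [Finite V] (G : SimpleGraph V) (S : Set V) :
    lambda (G.induce Sᶜ) ≤ lambda G + phi G S := by
  classical
  let B := {e : Sym2 V | e ∈ G.edgeSet ∧ ∃ x ∈ S, ∃ y, y ∉ S ∧ e = s(x, y)}
  let R (c : {c // IsDifficult (G.induce Sᶜ) c}) :
      {c // IsDifficult G c} ⊕ B → Prop
    | .inl d => d.1.supp = Subtype.val '' c.1.supp
    | .inr e => ∃ x ∈ S, ∃ y ∈ c.1.supp, e.1 = s(x, y.1)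
  have hR : ∀ c, ∃ d, R c d := by
    intro c
    by_cases hc : ∀ x ∈ c.1.supp, ∀ y, G.Adj x y → y ∈ Sᶜ
    · exact ⟨.inl ⟨_, c.2.extendComponent hc⟩, supp_extendComponent c.1 hc⟩
    · push Not at hc
      obtain ⟨x, hx, y, hxy, hy⟩ := hc
      have hy : y ∈ S := by simpa using hy
      exact ⟨.inr ⟨s(y, x), hxy.symm, y, hy, x, x.2, rfl⟩, y, hy, x, hx, rfl⟩
  choose f hf using hR
  have hinj : Function.Injective f := by
    intro c d hcd
    have hc := hf c
    have hd := hf d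
    rw [← hcd] at hd
    apply Subtype.ext
    rcases hfc : f c with e | e
    · rw [hfc] at hc hd
      exact SimpleGraph.ConnectedComponent.supp_injective
        (Subtype.val_injective.image_injective (hc.symm.trans hd))
    · rw [hfc] at hc hd
      obtain ⟨x, hx, y, hy, he⟩ := hc
      obtain ⟨x', hx', y', hy', he'⟩ := hd
      rcases Sym2.eq_iff.1 (he.symm.trans he') with ⟨-, h⟩ | ⟨h, -⟩
      · obtain rfl := Subtype.ext h
        exact hy.symm.trans hy'
      · exact absurd (h ▸ hx) y'.2
  calc lambda (G.induce Sᶜ) ≤ Nat.card ({c // IsDifficult G c} ⊕ B) :=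
        Nat.card_le_card_of_injective f hinj
    _ = lambda G + phi G S := Nat.card_sum

/-- In a minimum counterexample, a set containing a closed neighbourhood spans few edges. -/
theorem lt_ncard_sub_one_of_minimum_counterexample {a b : ℝ} (hb : 0 < b)
    {V : Type} [Fintype V] (G : SimpleGraph V) (hG : ¬ HasTriangleAdjC4 G)
    (hcex : (indepNum G : ℝ) <
      (Nat.card V : ℝ) - (a * Nat.card V + b * numEdges G + b * lambda G))
    (hmin : ∀ (W : Type) [Fintype W] (G' : SimpleGraph W),
      Nat.card W < Nat.card V → ¬ HasTriangleAdjC4 G' →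
      (indepNum G' : ℝ) ≥
        (Nat.card W : ℝ) - (a * Nat.card W + b * numEdges G' + b * lambda G'))
    {S : Set V} {v : V} (hv : v ∈ S) (hN : ∀ w, G.Adj v w → w ∈ S) :
    a * S.ncard + b * numEdges (G.induce S) < S.ncard - 1 := by
  classical
  have hcard : S.ncard + Nat.card ↥Sᶜ = Nat.card V := Set.ncard_add_ncard_compl S
  have hpos : 0 < S.ncard := (Set.ncard_pos).2 ⟨v, hv⟩
  have hα := indepNum_induce_compl_add_one_le G hv hN
  have hm := numEdges_induce_add_phi_add_le G S
  have hl := lambda_induce_compl_le G S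
  have hle := hmin ↥Sᶜ (G.induce Sᶜ) (by omega) (fun h => hG h.of_induce)
  rw [← hcard] at hcex
  have hsum : lambda (G.induce Sᶜ) + numEdges (G.induce Sᶜ) + numEdges (G.induce S) ≤
      lambda G + numEdges G := by omega
  have hsum' : (lambda (G.induce Sᶜ) + numEdges (G.induce Sᶜ) + numEdges (G.induce S) : ℝ) ≤
      lambda G + numEdges G := by exact_mod_cast hsum
  have hα' : (indepNum (G.induce Sᶜ) + 1 : ℝ) ≤ indepNum G := by exact_mod_cast hα
  have := mul_le_mul_of_nonneg_left hsum' hb.le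
  push_cast at hcex
  linarith

/-- Claim 2.3: the minimum degree of a minimum counterexample is at least two. -/
theorem claim_min_degree_two
(a b : ℝ) (ha : 0 < a) (hb : 0 < b)
    (h1 : 2 * a + b ≥ 1) (h2 : 3 * a + 4 * b ≥ 2) (h3 : 9 * a + 11 * b ≥ 6)
    (h4 : a + 5 * b ≥ 1) (h5 : 4 * a + 9 * b ≥ 3) (h6 : 10 * a + 16 * b ≥ 7)
    (h7 : 13 * a + 20 * b ≥ 8) (h8 : 5 * a + 14 * b ≥ 4)
    (h9 : a + (3 / 2) * b ≥ 2 / 3)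
{V : Type} [Fintype V] (G : SimpleGraph V)
    (hG : ¬ HasTriangleAdjC4 G)
    (hcex : (indepNum G : ℝ) <
      (Nat.card V : ℝ) - (a * Nat.card V + b * numEdges G + b * lambda G))
    (hmin : ∀ (W : Type) [Fintype W] (G' : SimpleGraph W),
      Nat.card W < Nat.card V → ¬ HasTriangleAdjC4 G' →
      (indepNum G' : ℝ) ≥
        (Nat.card W : ℝ) - (a * Nat.card W + b * numEdges G' + b * lambda G')) :
    ∀ v : V, 2 ≤ deg G v := by
  intro v
  by_contra! hlt
  have hkey {S : Set V} (hv : v ∈ S) (hN : ∀ w, G.Adj v w → w ∈ S) :=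
    lt_ncard_sub_one_of_minimum_counterexample hb G hG hcex hmin hv hN
  have hdeg : (G.neighborSet v).ncard ≤ 1 := Nat.le_of_lt_succ hlt
  rcases (Set.ncard_le_one_iff_eq (Set.toFinite _)).1 hdeg with h0 | ⟨u, hu⟩
  · have hS := hkey (S := {v}) rfl fun w hw => by
      have : w ∈ G.neighborSet v := hw
      simp [h0] at this
    have : 0 ≤ b * (numEdges (G.induce {v}) : ℝ) := by positivity
    simp only [Set.ncard_singleton, Nat.cast_one] at hS
    linarith
  · have hvu : G.Adj v u := by
      have : u ∈ G.neighborSet v := by simp [hu]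
      exact this
    have hS := hkey (S := {v, u}) (by simp) fun w hw => by
      have : w ∈ G.neighborSet v := hw
      rw [hu] at this
      exact Or.inr this
    have hedge : 1 ≤ numEdges (G.induce {v, u}) := by
      rw [numEdges_induce, Nat.succ_le_iff, Set.ncard_pos]
      exact ⟨s(v, u), hvu, by simp⟩
    have hedge' : (1 : ℝ) ≤ numEdges (G.induce {v, u}) := by exact_mod_cast hedge
    have := mul_le_mul_of_nonneg_left hedge' hb.le
    rw [Set.ncard_pair hvu.ne] at hS
    push_cast at hS
    linarith

end Paper
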